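/- Let (τ, u, S) be a C² solution of the one-dimensional Lagrangian compressible Euler equations on ℝ×[0,∞) with τ > 0, with C² initial data whose entropy has bounded variation (V < ∞), with 0 < M_L < m < M_U, |s̃(·,0)| < M_s, |r̃(·,0)| < M_r, and suppose there is M_* > 0 such that m(x) m''(x) − ((3γ+1)/(3γ−1)) m'(x)² ≤ M_* for all x. If 1 < γ < 3 assume additionally that ρ(x,t) ≥ ρ_L > 0 for all (x,t). Then there exists a positive constant N depending only on these constants (via γ, M_*, M_L, M_U, and the a priori upper bound E_U on η determined by the initial data) such that: if inf over x of min{y(x,0), q(x,0)} < −N, then no such global-in-time C² solution exists; that is, |u_x| and/or |τ_x| blow up in finite time. -/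

import Mathlib

open Real MeasureTheory

/-- partial derivative in the first (space) variable -/
noncomputable def pdx (f : ℝ → ℝ → ℝ) (x t : ℝ) : ℝ := deriv (fun x' => f x' t) x
/-- partial derivative in the second (time) variable -/
noncomputable def pdt (f : ℝ → ℝ → ℝ) (x t : ℝ) : ℝ := deriv (fun t' => f x t') t

theorem riccati_algebra (γ σ c m m1 m2 n P Q PX QX W κ b β d : ℝ) (hγ : 1 < γ)
    (hσ : σ = 1 ∨ σ = -1) (hm : 0 < m) (hn : 0 < n)
    (hκ : κ = 3 * (3 - γ) / (2 * (3 * γ - 1))) (hb : b = (γ + 1) / (2 * (γ - 1)))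
    (hβ : β = 2 / (3 * γ - 1)) (hd : d = (γ + 1) / (γ - 1)) 
    (G cx nd : ℝ) (hG : G = P + σ * (m1 * n + m * Q) - σ * β * m1 * n)
    (hcx : cx = c * (m1 / m + d * Q / n)) (hnd : nd = σ * c * Q - c / m * P) :
    W * (-κ * (m1 * (σ * c)) / m + b * nd / n) * G
      + W * ((σ * c * PX - (cx * m * Q + c * m1 * Q + c * m * QX
            + (γ - 1) / γ * (cx * n * m1 + c * Q * m1 + c * n * m2)))
        + σ * ((m2 * (σ * c) * n + m1 * nd) + (m1 * (σ * c) * Q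
            + m * (σ * c * QX - (cx / m * P - c * m1 / m ^ 2 * P + c / m * PX))))
        - σ * β * (m2 * (σ * c) * n + m1 * nd))
    = W * c * ((γ - 1) / (γ * (3 * γ - 1)) * (n / m)
        * (m * m2 - (3 * γ + 1) / (3 * γ - 1) * m1 ^ 2) - b * G ^ 2 / (m * n)) := by
  have h1 : γ - 1 ≠ 0 := by linarith
  have h2 : 3 * γ - 1 ≠ 0 := by linarith
  have h3 : γ ≠ 0 := by linarith
  subst hG hcx hnd hκ hb hβ hd
  rcases hσ with rfl | rfl <;> field_simp <;> ring

theorem riccati_blowup (w g : ℝ → ℝ) (A a N T : ℝ) (ha : 0 < a) (hT : 0 < T) (hN : 0 < N)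
    (hNA : 2 * A ≤ a * N ^ 2) (hNT : 2 ≤ a * N * T) (hc : ContinuousOn w (Set.Icc 0 T))
    (hd : ∀ t ∈ Set.Ioo 0 T, HasDerivAt w (g t) t)
    (hg : ∀ t ∈ Set.Ioo 0 T, g t ≤ A - a * w t ^ 2) (h0 : w 0 < -N) : False := by
  have hlt : ∀ t ∈ Set.Icc 0 T, w t < -N := by
    by_contra! hcon
    obtain ⟨t2, ht2, hw2⟩ := hcon
    have hcomp : IsCompact (Set.Icc 0 T ∩ w ⁻¹' Set.Ici (-N)) :=
      isCompact_Icc.of_isClosed_subset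
        (hc.preimage_isClosed_of_isClosed isClosed_Icc isClosed_Ici) Set.inter_subset_left
    obtain ⟨t1, ⟨ht1, hw1⟩, hmin⟩ := hcomp.exists_isLeast ⟨t2, ht2, hw2⟩
    have hbefore : ∀ t ∈ Set.Ioo 0 t1, w t < -N := by
      intro t ht
      by_contra! h
      exact absurd (hmin ⟨⟨ht.1.le, ht.2.le.trans ht1.2⟩, h⟩) (not_le.2 ht.2)
    have hanti : AntitoneOn w (Set.Icc 0 t1) := by
      refine antitoneOn_of_hasDerivWithinAt_nonpos (f' := g) (convex_Icc _ _)
        (hc.mono (Set.Icc_subset_Icc_right ht1.2)) ?_ ?_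
      · intro t ht
        rw [interior_Icc] at ht
        exact (hd t ⟨ht.1, ht.2.trans_le ht1.2⟩).hasDerivWithinAt
      · intro t ht
        rw [interior_Icc] at ht
        have h1 := hg t ⟨ht.1, ht.2.trans_le ht1.2⟩
        have h2 := hbefore t ht
        have h3 : N ^ 2 ≤ w t ^ 2 := by nlinarith
        nlinarith [mul_le_mul_of_nonneg_left h3 ha.le]
    have h4 := hanti ⟨le_refl _, ht1.1⟩ ⟨ht1.1, le_refl _⟩ ht1.1
    have h5 : -N ≤ w t1 := hw1
    linarith
  have hne : ∀ t ∈ Set.Icc 0 T, w t ≠ 0 := fun t ht => by linarith [hlt t ht]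
  have hmono : MonotoneOn (fun t => (w t)⁻¹ - a / 2 * t) (Set.Icc 0 T) := by
    refine monotoneOn_of_hasDerivWithinAt_nonneg (f' := fun t => -g t / w t ^ 2 - a / 2)
      (convex_Icc _ _) ((hc.inv₀ hne).sub (by fun_prop)) ?_ ?_
    · intro t ht
      rw [interior_Icc] at ht
      have h1 := ((hd t ht).inv (hne t ⟨ht.1.le, ht.2.le⟩)).sub
        ((hasDerivAt_id t).const_mul (a / 2))
      rw [mul_one] at h1
      exact h1.hasDerivWithinAt
    · intro t ht
      rw [interior_Icc] at ht
      have h1 := hg t ht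
      have h2 := hlt t ⟨ht.1.le, ht.2.le⟩
      have h3 : N ^ 2 ≤ w t ^ 2 := by nlinarith
      have h4 : 0 < w t ^ 2 := (pow_pos hN 2).trans_le h3
      rw [sub_nonneg, le_div_iff₀ h4]
      nlinarith [mul_le_mul_of_nonneg_left h3 ha.le]
  have h1 := hmono ⟨le_refl _, hT.le⟩ ⟨hT.le, le_refl _⟩ hT.le
  have h2 : (w T)⁻¹ < 0 := inv_lt_zero.2 (by linarith [hlt T ⟨hT.le, le_refl _⟩])
  have h3 : -N⁻¹ < (w 0)⁻¹ := by
    rw [← inv_neg]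
    exact (inv_lt_inv_of_neg (by linarith) (by linarith)).2 h0
  have h4 : N⁻¹ ≤ a / 2 * T := by
    rw [inv_le_iff_one_le_mul₀ hN]
    linarith
  simp only at h1
  linarith

/-- A semiconvexity bound on `m ^ (-β)` together with bounds on `m` controls the slope of `m`. -/
theorem abs_deriv_le_of_semiconvex (m : ℝ → ℝ) (hm : ContDiff ℝ 2 m) (β ML MU Ms : ℝ)
    (hβ : 0 < β) (hML : 0 < ML) (hMs : 0 < Ms) (hb : ∀ x, ML < m x ∧ m x < MU)
    (h : ∀ x, m x * deriv (deriv m) x - (β + 1) * deriv m x ^ 2 ≤ Ms) (x : ℝ) :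
    |deriv m x| ≤ (ML ^ (-β) + β * ML ^ (-β - 2) * Ms) * MU ^ (β + 1) / β := by
  have hpos : ∀ x, 0 < m x := fun x => hML.trans (hb x).1
  have hd1 : ∀ x, HasDerivAt m (deriv m x) x := fun x =>
    (hm.differentiable (by norm_num) x).hasDerivAt
  have hd2 : ∀ x, HasDerivAt (deriv m) (deriv (deriv m) x) x := fun x => by
    have : ContDiff ℝ 1 (deriv m) := by
      have : ContDiff ℝ (1 + 1) m := by simpa [one_add_one_eq_two] using hm
      exact (contDiff_succ_iff_deriv.1 this).2.2
    exact (this.differentiable (by norm_num) x).hasDerivAt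
  set φ : ℝ → ℝ := fun x => m x ^ (-β) with hφ
  set ψ : ℝ → ℝ := fun x => deriv m x * (-β) * m x ^ (-β - 1) with hψ
  have hφd : ∀ x, HasDerivAt φ (ψ x) x := fun x => (hd1 x).rpow_const (Or.inl (hpos x).ne')
  set L := β * ML ^ (-β - 2) * Ms with hL
  have hL0 : 0 < L := by positivity
  have hψd : ∀ x, HasDerivAt ψ (-β * m x ^ (-β - 2) *
      (m x * deriv (deriv m) x - (β + 1) * deriv m x ^ 2)) x := fun x => by
    have h1 := ((hd2 x).mul_const (-β)).fun_mul
      ((hd1 x).rpow_const (p := -β - 1) (Or.inl (hpos x).ne'))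
    refine h1.congr_deriv ?_
    have e1 : m x ^ (-β - 1) = m x ^ (-β - 2) * m x := by
      rw [← rpow_add_one (hpos x).ne']; congr 1; ring
    have e2 : -β - 1 - 1 = -β - 2 := by ring
    rw [e2, e1]; ring
  have hmono : Monotone fun x => ψ x + L * x := by
    refine monotone_of_hasDerivAt_nonneg (fun x => (hψd x).add ((hasDerivAt_id x).const_mul L)) ?_
    intro x
    have h1 : m x ^ (-β - 2) ≤ ML ^ (-β - 2) :=
      rpow_le_rpow_of_nonpos hML (hb x).1.le (by linarith)
    have h2 : 0 < m x ^ (-β - 2) := rpow_pos_of_pos (hpos x) _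
    have h3 : m x ^ (-β - 2) * (m x * deriv (deriv m) x - (β + 1) * deriv m x ^ 2)
        ≤ ML ^ (-β - 2) * Ms :=
      (mul_le_mul_of_nonneg_left (h x) h2.le).trans (mul_le_mul_of_nonneg_right h1 hMs.le)
    simp only [Pi.zero_apply, mul_one]
    nlinarith
  have hφb : ∀ x, 0 < φ x ∧ φ x ≤ ML ^ (-β) := fun x =>
    ⟨rpow_pos_of_pos (hpos x) _, rpow_le_rpow_of_nonpos hML (hb x).1.le (by linarith)⟩
  have hψb : |ψ x| ≤ ML ^ (-β) + L := by
    have hcont : Continuous φ := continuous_iff_continuousAt.2 fun x => (hφd x).continuousAt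
    obtain ⟨ξ, hξ, hξe⟩ := exists_hasDerivAt_eq_slope φ ψ (show x < x + 1 by linarith)
      hcont.continuousOn fun z _ => hφd z
    obtain ⟨ζ, hζ, hζe⟩ := exists_hasDerivAt_eq_slope φ ψ (show x - 1 < x by linarith)
      hcont.continuousOn fun z _ => hφd z
    rw [show x + 1 - x = 1 by ring, div_one] at hξe
    rw [show x - (x - 1) = 1 by ring, div_one] at hζe
    have h1 := hmono hξ.1.le
    have h2 := hmono hζ.2.le
    simp only at h1 h2
    have := hφb x
    have := hφb (x + 1)
    have := hφb (x - 1)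
    rw [abs_le]
    constructor <;> nlinarith [hξ.1, hξ.2, hζ.1, hζ.2]
  have e : |deriv m x| = |ψ x| * m x ^ (β + 1) / β := by
    simp only [hψ, abs_mul, abs_neg, abs_of_pos hβ, abs_of_pos (rpow_pos_of_pos (hpos x) _)]
    rw [mul_assoc (|deriv m x| * β), ← rpow_add (hpos x)]
    rw [show -β - 1 + (β + 1) = 0 by ring, rpow_zero]
    field_simp
  rw [e]
  have : m x ^ (β + 1) ≤ MU ^ (β + 1) :=
    rpow_le_rpow (hpos x).le (hb x).2.le (by linarith)
  gcongr
  exact rpow_nonneg (hpos x).le _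

/-- Functions transported with speed at most `C` and growth rate below `D` stay below `M + D t`,
as long as the rate bound holds whenever all of them obey this bound. -/
theorem transport_bound {ι : Type*} [Finite ι] (w : ι → ℝ → ℝ → ℝ) (C D M T : ℝ) (hC : 0 ≤ C)
    (hcont : ∀ i, ContinuousOn (fun q : ℝ × ℝ => w i q.1 q.2) (Set.univ ×ˢ Set.Ici (0:ℝ)))
    (h0 : ∀ i x, w i x 0 < M)
    (hstep : ∀ x t, 0 < t → t ≤ T → (∀ i, w i x t ≤ M + D * t) →
      ∀ i, ∃ v g, |v| ≤ C ∧ g < D ∧ HasDerivAt (fun t' => w i (x + v * (t' - t)) t') g t)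
    (i : ι) (x t : ℝ) (ht : 0 ≤ t) (htT : t ≤ T) : w i x t < M + D * t := by
  by_contra! hbad
  set Ω : Set (ℝ × ℝ) := {q | 0 ≤ q.2 ∧ q.2 ≤ t ∧ |q.1 - x| ≤ C * (t - q.2)} with hΩ
  have hΩH : Ω ⊆ Set.univ ×ˢ Set.Ici (0:ℝ) := fun q hq => ⟨trivial, hq.1⟩
  have hΩclosed : IsClosed Ω := by
    refine IsClosed.and (isClosed_le (by fun_prop) (by fun_prop)) ?_
    exact IsClosed.and (isClosed_le (by fun_prop) (by fun_prop))
      (isClosed_le (by fun_prop) (by fun_prop))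
  have hΩcomp : IsCompact Ω := by
    refine (isCompact_Icc (a := ((x - C * t, 0) : ℝ × ℝ)) (b := (x + C * t, t))).of_isClosed_subset
      hΩclosed ?_
    rintro ⟨a, b⟩ ⟨h1, h2, h3⟩
    simp only at h1 h2 h3
    rw [abs_le] at h3
    have : 0 ≤ C * b := by positivity
    exact ⟨⟨by simp only; linarith, h1⟩, ⟨by simp only; linarith, h2⟩⟩
  set bad : Set (ℝ × ℝ) := ⋃ j, Ω ∩ (fun q : ℝ × ℝ => w j q.1 q.2 - D * q.2) ⁻¹' Set.Ici M
    with hbaddef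
  have hbadcomp : IsCompact bad := by
    refine isCompact_iUnion fun j => hΩcomp.of_isClosed_subset ?_ Set.inter_subset_left
    exact (((hcont j).mono hΩH).sub (by fun_prop)).preimage_isClosed_of_isClosed hΩclosed
      isClosed_Ici
  have hbadne : bad.Nonempty := by
    refine ⟨(x, t), Set.mem_iUnion.2 ⟨i, ⟨ht, le_refl _, by simp⟩, ?_⟩⟩
    simp only [Set.mem_preimage, Set.mem_Ici]
    linarith
  obtain ⟨⟨x1, t1⟩, hmem, hmin⟩ :=
    hbadcomp.exists_isMinOn hbadne (f := Prod.snd) continuous_snd.continuousOn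
  obtain ⟨j, ⟨ht1, ht1t, hx1⟩, hj⟩ := Set.mem_iUnion.1 hmem
  simp only [Set.mem_preimage, Set.mem_Ici] at hj ht1 ht1t hx1
  have hgood : ∀ q ∈ Ω, q.2 < t1 → ∀ k, w k q.1 q.2 < M + D * q.2 := by
    intro q hq hqt k
    by_contra! hk
    have : q ∈ bad := Set.mem_iUnion.2 ⟨k, hq, by
      simp only [Set.mem_preimage, Set.mem_Ici]; linarith⟩
    have h1 : t1 ≤ q.2 := hmin this
    linarith
  have ht1pos : 0 < t1 := by
    rcases ht1.lt_or_eq with h | h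
    · exact h
    · subst h
      linarith [h0 j x1]
  have hle : ∀ k, w k x1 t1 ≤ M + D * t1 := by
    intro k
    have hcw : ContinuousWithinAt (fun s => w k x1 s) (Set.Iio t1) t1 := by
      have h1 : ContinuousAt (fun q : ℝ × ℝ => w k q.1 q.2) (x1, t1) :=
        (hcont k).continuousAt (by
          rw [mem_nhds_prod_iff]
          exact ⟨Set.univ, Filter.univ_mem, Set.Ici 0, Ici_mem_nhds ht1pos, le_refl _⟩)
      exact (h1.comp (f := fun s : ℝ => (x1, s)) (x := t1)
        (by fun_prop)).continuousWithinAt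
    refine le_of_tendsto_of_tendsto hcw
      (show Filter.Tendsto (fun s => M + D * s) (nhdsWithin t1 (Set.Iio t1)) _ from
        (by fun_prop : Continuous fun s : ℝ => M + D * s).continuousAt.continuousWithinAt) ?_
    filter_upwards [Ioo_mem_nhdsLT ht1pos] with s hs
    refine (hgood (x1, s) ⟨hs.1.le, hs.2.le.trans ht1t, hx1.trans ?_⟩ hs.2 k).le
    simp only
    gcongr
    exact hs.2.le
  obtain ⟨v, g, hv, hgD, hder⟩ := hstep x1 t1 ht1pos (ht1t.trans htT) hle j
  have hder2 : HasDerivAt (fun t' => w j (x1 + v * (t' - t1)) t' - D * t') (g - D) t1 := by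
    simpa using hder.fun_sub ((hasDerivAt_id t1).const_mul D)
  have hneg : ∀ᶠ s in nhdsWithin t1 (Set.Iio t1),
      w j (x1 + v * (s - t1)) s - D * s < w j (x1 + v * (t1 - t1)) t1 - D * t1 := by
    filter_upwards [Ioo_mem_nhdsLT ht1pos] with s hs
    have h1 := hgood (x1 + v * (s - t1), s) ⟨hs.1.le, hs.2.le.trans ht1t, by
      simp only
      have h2 : |x1 + v * (s - t1) - x| ≤ |x1 - x| + |v| * (t1 - s) := by
        rw [show x1 + v * (s - t1) - x = (x1 - x) + v * (s - t1) by ring]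
        refine (abs_add_le _ _).trans ?_
        rw [abs_mul, abs_of_neg (by linarith [hs.2] : s - t1 < 0)]
        linarith
      nlinarith [hs.2]⟩ hs.2 j
    simp only at h1
    simp only [sub_self, mul_zero, add_zero]
    linarith
  have hslope := (hasDerivWithinAt_iff_tendsto_slope' (by simp)).1
    (hder2.hasDerivWithinAt (s := Set.Iio t1))
  have : 0 ≤ g - D := by
    refine ge_of_tendsto hslope ?_
    filter_upwards [hneg, self_mem_nhdsWithin] with s hs hst
    rw [slope_def_field]
    have hst' : s < t1 := hst
    exact div_nonneg_of_nonpos (by linarith) (by linarith)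
  linarith

section HalfPlane

variable {f : ℝ → ℝ → ℝ}

theorem uniqueDiffOn_halfPlane : UniqueDiffOn ℝ (Set.univ ×ˢ Set.Ici (0:ℝ) : Set (ℝ × ℝ)) :=
  uniqueDiffOn_univ.prod (uniqueDiffOn_Ici 0)

theorem halfPlane_mem_nhds {x t : ℝ} (ht : 0 < t) :
    (Set.univ ×ˢ Set.Ici (0:ℝ) : Set (ℝ × ℝ)) ∈ nhds (x, t) :=
  prod_mem_nhds Filter.univ_mem (Ici_mem_nhds ht)

theorem hasDerivAt_slice
    (hf : ContDiffOn ℝ 1 (fun q : ℝ × ℝ => f q.1 q.2) (Set.univ ×ˢ Set.Ici (0:ℝ)))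
    (x : ℝ) {t : ℝ} (ht : 0 ≤ t) :
    HasDerivAt (fun x' => f x' t)
      (fderivWithin ℝ (fun q : ℝ × ℝ => f q.1 q.2) (Set.univ ×ˢ Set.Ici (0:ℝ)) (x, t) (1, 0)) x := by
  have h1 := ((hf.differentiableOn (by norm_num)) (x, t) ⟨trivial, ht⟩).hasFDerivWithinAt
  have h2 : HasDerivWithinAt (fun x' : ℝ => (x', t)) ((1 : ℝ), (0 : ℝ)) Set.univ x :=
    ((hasDerivAt_id x).prodMk (hasDerivAt_const x t)).hasDerivWithinAt
  have h3 := h1.comp_hasDerivWithinAt (f := fun x' : ℝ => (x', t)) x h2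
    (fun y _ => Set.mk_mem_prod trivial ht)
  exact HasDerivWithinAt.hasDerivAt h3 Filter.univ_mem

theorem hasDerivAt_pdx
    (hf : ContDiffOn ℝ 1 (fun q : ℝ × ℝ => f q.1 q.2) (Set.univ ×ˢ Set.Ici (0:ℝ)))
    (x : ℝ) {t : ℝ} (ht : 0 ≤ t) : HasDerivAt (fun x' => f x' t) (pdx f x t) x :=
  (hasDerivAt_slice hf x ht).differentiableAt.hasDerivAt

theorem contDiffOn_pdx
    (hf : ContDiffOn ℝ 2 (fun q : ℝ × ℝ => f q.1 q.2) (Set.univ ×ˢ Set.Ici (0:ℝ))) :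
    ContDiffOn ℝ 1 (fun q : ℝ × ℝ => pdx f q.1 q.2) (Set.univ ×ˢ Set.Ici (0:ℝ)) := by
  have h1 : ContDiffOn ℝ 1 (fun q => fderivWithin ℝ (fun q : ℝ × ℝ => f q.1 q.2)
      (Set.univ ×ˢ Set.Ici (0:ℝ)) q (1, 0)) (Set.univ ×ˢ Set.Ici (0:ℝ)) :=
    (hf.fderivWithin uniqueDiffOn_halfPlane (by norm_num [one_add_one_eq_two])).clm_apply
      contDiffOn_const
  exact h1.congr fun q hq => (hasDerivAt_slice (hf.of_le (by norm_num)) q.1 hq.2).deriv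

theorem continuousOn_pdx
    (hf : ContDiffOn ℝ 1 (fun q : ℝ × ℝ => f q.1 q.2) (Set.univ ×ˢ Set.Ici (0:ℝ))) :
    ContinuousOn (fun q : ℝ × ℝ => pdx f q.1 q.2) (Set.univ ×ˢ Set.Ici (0:ℝ)) := by
  have h1 : ContinuousOn (fun q => fderivWithin ℝ (fun q : ℝ × ℝ => f q.1 q.2)
      (Set.univ ×ˢ Set.Ici (0:ℝ)) q (1, 0)) (Set.univ ×ˢ Set.Ici (0:ℝ)) :=
    (hf.continuousOn_fderivWithin uniqueDiffOn_halfPlane (by norm_num)).clm_apply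
      continuousOn_const
  exact h1.congr fun q hq => (hasDerivAt_slice hf q.1 hq.2).deriv

theorem HasFDerivAt.hasDerivAt_fst {E : Type*} [NormedAddCommGroup E] [NormedSpace ℝ E]
    {F : ℝ × ℝ → E} {L : ℝ × ℝ →L[ℝ] E} {x t : ℝ} (h : HasFDerivAt F L (x, t)) :
    HasDerivAt (fun x' => F (x', t)) (L (1, 0)) x :=
  h.comp_hasDerivAt (f := fun x' => (x', t)) x
    ((hasDerivAt_id x).prodMk (hasDerivAt_const x t))

theorem HasFDerivAt.hasDerivAt_snd {E : Type*} [NormedAddCommGroup E] [NormedSpace ℝ E]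
    {F : ℝ × ℝ → E} {L : ℝ × ℝ →L[ℝ] E} {x t : ℝ} (h : HasFDerivAt F L (x, t)) :
    HasDerivAt (fun t' => F (x, t')) (L (0, 1)) t :=
  h.comp_hasDerivAt (f := fun t' => (x, t')) t
    ((hasDerivAt_const t x).prodMk (hasDerivAt_id t))

theorem hasDerivAt_along
    (hf : ContDiffOn ℝ 1 (fun q : ℝ × ℝ => f q.1 q.2) (Set.univ ×ˢ Set.Ici (0:ℝ)))
    {X : ℝ → ℝ} {v t : ℝ} (ht : 0 < t) (hX : HasDerivAt X v t) :
    HasDerivAt (fun t' => f (X t') t') (v * pdx f (X t) t + pdt f (X t) t) t := by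
  have hF := ((hf.contDiffAt (halfPlane_mem_nhds (x := X t) ht)).differentiableAt
    (by norm_num)).hasFDerivAt
  have h1 := hF.comp_hasDerivAt (f := fun t' => (X t', t')) t (hX.prodMk (hasDerivAt_id t))
  have hx : pdx f (X t) t = _ := hF.hasDerivAt_fst.deriv
  have ht' : pdt f (X t) t = _ := hF.hasDerivAt_snd.deriv
  refine h1.congr_deriv ?_
  rw [hx, ht', ← smul_eq_mul, ← map_smul, ← map_add]
  simp

theorem hasDerivAt_pdt
    (hf : ContDiffOn ℝ 1 (fun q : ℝ × ℝ => f q.1 q.2) (Set.univ ×ˢ Set.Ici (0:ℝ)))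
    (x : ℝ) {t : ℝ} (ht : 0 < t) : HasDerivAt (fun t' => f x t') (pdt f x t) t := by
  simpa using hasDerivAt_along hf ht (hasDerivAt_const t x)

theorem pdt_pdx_comm
    (hf : ContDiffOn ℝ 2 (fun q : ℝ × ℝ => f q.1 q.2) (Set.univ ×ˢ Set.Ici (0:ℝ)))
    (x : ℝ) {t : ℝ} (ht : 0 < t) : pdt (pdx f) x t = pdx (pdt f) x t := by
  set F : ℝ × ℝ → ℝ := fun q => f q.1 q.2 with hFdef
  have hat : ∀ x t, 0 < t → ContDiffAt ℝ 2 F (x, t) := fun x t ht =>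
    hf.contDiffAt (halfPlane_mem_nhds ht)
  have hF : ∀ x t, 0 < t → HasFDerivAt F (fderiv ℝ F (x, t)) (x, t) := fun x t ht =>
    ((hat x t ht).differentiableAt (by norm_num)).hasFDerivAt
  have hx : ∀ x t, 0 < t → pdx f x t = fderiv ℝ F (x, t) (1, 0) := fun x t ht =>
    (hF x t ht).hasDerivAt_fst.deriv
  have ht' : ∀ x t, 0 < t → pdt f x t = fderiv ℝ F (x, t) (0, 1) := fun x t ht =>
    (hF x t ht).hasDerivAt_snd.deriv
  have h2 : HasFDerivAt (fderiv ℝ F) (fderiv ℝ (fderiv ℝ F) (x, t)) (x, t) :=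
    (((hat x t ht).fderiv_right (m := 1) (by norm_num [one_add_one_eq_two])).differentiableAt
      (by norm_num)).hasFDerivAt
  have hsymm := (hat x t ht).isSymmSndFDerivAt (by simp)
  have e1 : pdt (pdx f) x t = fderiv ℝ (fderiv ℝ F) (x, t) (0, 1) (1, 0) := by
    have h3 := h2.hasDerivAt_snd.clm_apply (hasDerivAt_const t ((1 : ℝ), (0 : ℝ)))
    have h4 : (fun t' => pdx f x t') =ᶠ[nhds t]
        fun t' => fderiv ℝ F (x, t') ((1 : ℝ), (0 : ℝ)) := by
      filter_upwards [Ioi_mem_nhds ht] with s hs using hx x s hs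
    have h5 := (h3.congr_of_eventuallyEq h4).deriv
    rw [map_zero, add_zero] at h5
    exact h5
  have e2 : pdx (pdt f) x t = fderiv ℝ (fderiv ℝ F) (x, t) (1, 0) (0, 1) := by
    have h3 := h2.hasDerivAt_fst.clm_apply (hasDerivAt_const x ((0 : ℝ), (1 : ℝ)))
    have h4 : (fun x' => pdt f x' t) = fun x' => fderiv ℝ F (x', t) ((0 : ℝ), (1 : ℝ)) :=
      funext fun y => ht' y t ht
    rw [← h4] at h3
    have h5 := h3.deriv
    rw [map_zero, add_zero] at h5
    exact h5
  rw [e1, e2]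
  exact hsymm _ _

/-- Existence of an integral curve of a bounded `C¹` speed on a finite time interval. -/
theorem exists_characteristic
    (hf : ContDiffOn ℝ 1 (fun q : ℝ × ℝ => f q.1 q.2) (Set.univ ×ˢ Set.Ici (0:ℝ)))
    (C T x0 : ℝ) (hC : 0 ≤ C) (hT : 0 ≤ T)
    (hb : ∀ x t, 0 ≤ t → t ≤ T → |f x t| ≤ C) :
    ∃ X : ℝ → ℝ, X 0 = x0 ∧ ContinuousOn X (Set.Icc 0 T) ∧
      ∀ t ∈ Set.Ioo 0 T, HasDerivAt X (f (X t) t) t := by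
  have hsub : (Metric.closedBall x0 (C * T) ×ˢ Set.Icc 0 T : Set (ℝ × ℝ)) ⊆
      Set.univ ×ˢ Set.Ici (0:ℝ) := fun q hq => ⟨trivial, hq.2.1⟩
  obtain ⟨K, hK⟩ := ((isCompact_closedBall x0 (C * T)).prod
    (isCompact_Icc (a := (0:ℝ)) (b := T))).exists_bound_of_continuousOn
      ((continuousOn_pdx hf).mono hsub)
  have hPL : IsPicardLindelof (fun t x => f x t) (tmin := 0) (tmax := T) ⟨0, le_refl _, hT⟩ x0
      (C * T).toNNReal 0 C.toNNReal K.toNNReal := by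
    have hCT : 0 ≤ C * T := by positivity
    refine ⟨fun t ht => ?_, fun x _ => ?_, fun t ht x _ => ?_, ?_⟩
    · rw [Real.coe_toNNReal _ hCT]
      refine (convex_closedBall _ _).lipschitzOnWith_of_nnnorm_deriv_le
        (fun x _ => (hasDerivAt_slice hf x ht.1).differentiableAt) fun x hx => ?_
      rw [← NNReal.coe_le_coe, coe_nnnorm]
      exact le_trans (hK (x, t) ⟨hx, ht⟩) (Real.le_coe_toNNReal K)
    · exact hf.continuousOn.comp (f := fun t : ℝ => (x, t)) (s := Set.Icc 0 T) (by fun_prop)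
        fun t ht => ⟨trivial, ht.1⟩
    · rw [Real.coe_toNNReal _ hC]
      exact hb x t ht.1 ht.2
    · simp [Real.coe_toNNReal _ hCT, Real.coe_toNNReal _ hC, hT]
  obtain ⟨X, hX0, hX⟩ := hPL.exists_eq_forall_mem_Icc_hasDerivWithinAt₀
  exact ⟨X, hX0, fun t ht => (hX t ht).continuousWithinAt,
    fun t ht => (hX t ⟨ht.1.le, ht.2.le⟩).hasDerivAt (Icc_mem_nhds ht.1 ht.2)⟩

end HalfPlane

theorem exists_pos_le_rpow (a b e : ℝ) (ha : 0 < a) :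
    ∃ k > 0, ∀ x, a ≤ x → x ≤ b → k ≤ x ^ e := by
  rcases le_or_gt b 0 with hb | hb
  · exact ⟨1, one_pos, fun x h1 h2 => by linarith⟩
  rcases le_or_gt 0 e with he | he
  · exact ⟨a ^ e, rpow_pos_of_pos ha _, fun x h1 _ => rpow_le_rpow ha.le h1 he⟩
  · exact ⟨b ^ e, rpow_pos_of_pos hb _, fun x h1 h2 =>
      rpow_le_rpow_of_nonpos (ha.trans_le h1) h2 he.le⟩

section Riccati

variable {γ κ b β d Kc : ℝ} {u η : ℝ → ℝ → ℝ} {m : ℝ → ℝ}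

/-- The Riccati equation for the weighted gradient of the Riemann invariant `u + σ m η`
along the characteristics of the family `σ`. -/
theorem hasDerivAt_weighted_gradient (hγ : 1 < γ)
    (hκ : κ = 3 * (3 - γ) / (2 * (3 * γ - 1))) (hb : b = (γ + 1) / (2 * (γ - 1)))
    (hβ : β = 2 / (3 * γ - 1)) (hd : d = (γ + 1) / (γ - 1))
    (hu : ContDiffOn ℝ 2 (fun q : ℝ × ℝ => u q.1 q.2) (Set.univ ×ˢ Set.Ici (0:ℝ)))
    (hη : ContDiffOn ℝ 2 (fun q : ℝ × ℝ => η q.1 q.2) (Set.univ ×ˢ Set.Ici (0:ℝ)))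
    (hm : ContDiff ℝ 2 m) (hmpos : ∀ x, 0 < m x) (hηpos : ∀ x t, 0 ≤ t → 0 < η x t)
    (hηt : ∀ x t, 0 < t → pdt η x t = -(Kc * η x t ^ d * pdx u x t))
    (hut : ∀ x t, 0 < t → pdt u x t = -(Kc * m x * η x t ^ d * m x * pdx η x t
      + (γ - 1) / γ * (Kc * m x * η x t ^ d * η x t * deriv m x)))
    {σ : ℝ} (hσ : σ = 1 ∨ σ = -1) {X : ℝ → ℝ} {t : ℝ} (ht : 0 < t)
    (hX : HasDerivAt X (σ * (Kc * m (X t) * η (X t) t ^ d)) t) :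
    HasDerivAt (fun s => m (X s) ^ (-κ) * η (X s) s ^ b *
        (pdx u (X s) s + σ * (deriv m (X s) * η (X s) s + m (X s) * pdx η (X s) s)
          - σ * β * deriv m (X s) * η (X s) s))
      (m (X t) ^ (-κ) * η (X t) t ^ b * (Kc * m (X t) * η (X t) t ^ d) *
        ((γ - 1) / (γ * (3 * γ - 1)) * (η (X t) t / m (X t))
          * (m (X t) * deriv (deriv m) (X t)
            - (3 * γ + 1) / (3 * γ - 1) * deriv m (X t) ^ 2)
          - b * (pdx u (X t) t
              + σ * (deriv m (X t) * η (X t) t + m (X t) * pdx η (X t) t)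
              - σ * β * deriv m (X t) * η (X t) t) ^ 2 / (m (X t) * η (X t) t))) t := by
  have hu1 : ContDiffOn ℝ 1 (fun q : ℝ × ℝ => u q.1 q.2) (Set.univ ×ˢ Set.Ici (0:ℝ)) :=
    hu.of_le (by norm_num)
  have hη1 : ContDiffOn ℝ 1 (fun q : ℝ × ℝ => η q.1 q.2) (Set.univ ×ˢ Set.Ici (0:ℝ)) :=
    hη.of_le (by norm_num)
  have hux := contDiffOn_pdx hu
  have hηx := contDiffOn_pdx hη
  have hm' : ∀ x, HasDerivAt m (deriv m x) x := fun x =>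
    (hm.differentiable (by norm_num) x).hasDerivAt
  have hm'' : ∀ x, HasDerivAt (deriv m) (deriv (deriv m) x) x := fun x =>
    (((contDiff_succ_iff_deriv (n := 1)).1
      (by simpa [one_add_one_eq_two] using hm)).2.2.differentiable (by norm_num) x).hasDerivAt
  set x := X t with hx
  have hmx := hmpos x
  have hηxt := hηpos x t ht.le
  set c := Kc * m x * η x t ^ d with hc
  set cx := c * (deriv m x / m x + d * pdx η x t / η x t) with hcx
  have hslη : HasDerivAt (fun x' => η x' t) (pdx η x t) x := hasDerivAt_pdx hη1 x ht.le
  have hslηx : HasDerivAt (fun x' => pdx η x' t) (pdx (pdx η) x t) x := hasDerivAt_pdx hηx x ht.le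
  have hslux : HasDerivAt (fun x' => pdx u x' t) (pdx (pdx u) x t) x := hasDerivAt_pdx hux x ht.le
  have hpow : HasDerivAt (fun x' => η x' t ^ d) (η x t ^ d * (d * pdx η x t / η x t)) x := by
    refine (hslη.rpow_const (p := d) (Or.inl hηxt.ne')).congr_deriv ?_
    rw [rpow_sub_one hηxt.ne']
    field_simp
  have hcd : HasDerivAt (fun x' => Kc * m x' * η x' t ^ d) cx x := by
    refine (((hm' x).const_mul Kc).fun_mul hpow).congr_deriv ?_
    rw [hcx, hc]
    field_simp
  have hPt : pdt (pdx u) x t = -(cx * m x * pdx η x t + c * deriv m x * pdx η x t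
      + c * m x * pdx (pdx η) x t + (γ - 1) / γ * (cx * η x t * deriv m x
        + c * pdx η x t * deriv m x + c * η x t * deriv (deriv m) x)) := by
    rw [pdt_pdx_comm hu x ht]
    have h1 := ((((hcd.fun_mul (hm' x)).fun_mul hslηx).fun_add
      (((hcd.fun_mul hslη).fun_mul (hm'' x)).const_mul ((γ - 1) / γ))).fun_neg)
    have h2 : (fun x' => pdt u x' t) = _ := funext fun x' => hut x' t ht
    rw [← h2] at h1
    refine h1.deriv.trans ?_
    rw [← hc]
    ring
  have hQt : pdt (pdx η) x t = -(cx / m x * pdx u x t - c * deriv m x / m x ^ 2 * pdx u x t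
      + c / m x * pdx (pdx u) x t) := by
    rw [pdt_pdx_comm hη x ht]
    have h1 := (((hpow.const_mul Kc).fun_mul hslux).fun_neg)
    have h2 : (fun x' => pdt η x' t) = _ := funext fun x' => hηt x' t ht
    rw [← h2] at h1
    refine h1.deriv.trans ?_
    rw [hcx, hc]
    field_simp
    ring
  have aη := hasDerivAt_along hη1 ht hX
  have aP := hasDerivAt_along hux ht hX
  have aQ := hasDerivAt_along hηx ht hX
  rw [← hx] at aη aP aQ
  rw [hηt x t ht] at aη
  rw [hPt] at aP
  rw [hQt] at aQ
  have am : HasDerivAt (fun s => m (X s)) (deriv m x * (σ * c)) t := (hm' (X t)).comp t hX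
  have am1 : HasDerivAt (fun s => deriv m (X s)) (deriv (deriv m) x * (σ * c)) t :=
    (hm'' (X t)).comp t hX
  have key := riccati_algebra γ σ c (m x) (deriv m x) (deriv (deriv m) x) (η x t) (pdx u x t)
    (pdx η x t) (pdx (pdx u) x t) (pdx (pdx η) x t) (m x ^ (-κ) * η x t ^ b) κ b β d hγ hσ hmx hηxt
    hκ hb hβ hd _ cx _ rfl hcx rfl
  have hG := (aP.fun_add (((am1.fun_mul aη).fun_add (am.fun_mul aQ)).const_mul σ)).fun_sub
    ((am1.const_mul (σ * β)).fun_mul aη)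
  have hW := (am.rpow_const (p := -κ) (Or.inl hmx.ne')).fun_mul
    (aη.rpow_const (p := b) (Or.inl hηxt.ne'))
  refine ((hW.fun_mul hG).congr_deriv ?_).congr_of_eventuallyEq ?_
  · rw [← hx] at *
    rw [← key, rpow_sub_one hmx.ne', rpow_sub_one hηxt.ne', hc]
    field_simp
    ring
  · filter_upwards with s
    ring

end Riccati

theorem riccati_coefficient_bound {γ κ b d Kc E Mstar k1 k2 μ n Z G : ℝ} (hγ : 1 < γ)
    (hb : 0 < b) (hdb : d = 2 * b) (hKc : 0 < Kc) (hMstar : 0 < Mstar)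
    (hk1 : 0 < k1) (hk2 : 0 < k2) (hmx : 0 < μ) (hn : 0 < n) (hnE : n ≤ E)
    (hkm : k1 ≤ μ ^ κ) (hkη : k2 ≤ n ^ (b - 1)) (hst : Z ≤ Mstar) :
    μ ^ (-κ) * n ^ b * (Kc * μ * n ^ d) *
        ((γ - 1) / (γ * (3 * γ - 1)) * (n / μ) * Z - b * G ^ 2 / (μ * n))
      ≤ (γ - 1) / (γ * (3 * γ - 1)) * Kc * k1⁻¹ * E ^ (b + d + 1) * Mstar
        - Kc * b * k1 * k2 * (μ ^ (-κ) * n ^ b * G) ^ 2 := by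
  have hγ1 : 0 < γ - 1 := by linarith
  have hγ0 : 0 < γ := by linarith
  have hγ3 : 0 < 3 * γ - 1 := by linarith
  have hE : 0 < E := hn.trans_le hnE
  have e1 : μ ^ (-κ) = (μ ^ κ)⁻¹ := rpow_neg hmx.le _
  have e2 : n ^ (b + d + 1) = n ^ b * n ^ d * n := by
    rw [rpow_add_one hn.ne', rpow_add hn]
  have e3 : n ^ d = n ^ (b - 1) * n * n ^ b := by
    rw [← rpow_add_one hn.ne', ← rpow_add hn, hdb]
    congr 1
    ring
  have h1 : n ^ (b + d + 1) ≤ E ^ (b + d + 1) := rpow_le_rpow hn.le hnE (by rw [hdb]; positivity)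
  have h2 : (μ ^ κ)⁻¹ ≤ k1⁻¹ := inv_anti₀ hk1 hkm
  have hμκ : 0 < μ ^ κ := rpow_pos_of_pos hmx _
  have hlow : Kc * b * k1 * k2 * (μ ^ (-κ) * n ^ b * G) ^ 2
      ≤ Kc * b * μ ^ κ * n ^ (b - 1) * (μ ^ (-κ) * n ^ b * G) ^ 2 := by
    gcongr
  have hup : (γ - 1) / (γ * (3 * γ - 1)) * Kc * (μ ^ κ)⁻¹ * n ^ (b + d + 1) * Z
      ≤ (γ - 1) / (γ * (3 * γ - 1)) * Kc * k1⁻¹ * E ^ (b + d + 1) * Mstar := by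
    refine (mul_le_mul_of_nonneg_left hst (by positivity)).trans ?_
    gcongr
  refine le_trans (le_of_eq ?_) (sub_le_sub hup hlow)
  rw [e2, e1, e3]
  field_simp

/-- Short-time control of `η` and of the wave speed. -/
theorem short_time_bound {γ d Kc ML MU M B E C D T : ℝ} (hγ : 1 < γ) (hd0 : 0 < d)
    (hKc : 0 < Kc) (hML : 0 < ML) (hMU : 0 < MU) (hM : 0 < M)
    (hE : E = 2 * M / ML) (hC : C = Kc * MU * E ^ d) (hD : D = C * B * E / γ + 1)
    (hD0 : 0 < D) (hDT : D * T = M) {u η : ℝ → ℝ → ℝ} {m : ℝ → ℝ}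
    (hu1 : ContDiffOn ℝ 1 (fun q : ℝ × ℝ => u q.1 q.2) (Set.univ ×ˢ Set.Ici (0:ℝ)))
    (hη1 : ContDiffOn ℝ 1 (fun q : ℝ × ℝ => η q.1 q.2) (Set.univ ×ˢ Set.Ici (0:ℝ)))
    (hm : ContDiff ℝ 2 m) (hmb : ∀ x, ML ≤ m x ∧ m x ≤ MU) (hmB : ∀ x, |deriv m x| ≤ B)
    (hηpos : ∀ x t, 0 ≤ t → 0 < η x t)
    (hηt : ∀ x t, 0 < t → pdt η x t = -(Kc * η x t ^ d * pdx u x t))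
    (hut : ∀ x t, 0 < t → pdt u x t = -(Kc * m x * η x t ^ d * m x * pdx η x t
      + (γ - 1) / γ * (Kc * m x * η x t ^ d * η x t * deriv m x)))
    (hs0 : ∀ x, |u x 0 + m x * η x 0| < M) (hr0 : ∀ x, |u x 0 - m x * η x 0| < M)
    (x t : ℝ) (ht : 0 ≤ t) (htT : t ≤ T) :
    η x t ≤ E ∧ 0 < Kc * m x * η x t ^ d ∧ Kc * m x * η x t ^ d ≤ C := by
  have hγ0 : 0 < γ := by linarith
  have hE0 : 0 < E := by rw [hE]; positivity
  have hC0 : 0 < C := by rw [hC]; positivity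
  have hmpos : ∀ x, 0 < m x := fun x => hML.trans_le (hmb x).1
  have hm' : ∀ x, HasDerivAt m (deriv m x) x := fun x =>
    (hm.differentiable (by norm_num) x).hasDerivAt
  have hspeed : ∀ x n, 0 < n → n ≤ E →
      0 < Kc * m x * n ^ d ∧ Kc * m x * n ^ d ≤ C := by
    intro x n hn hnE
    have := hmpos x
    refine ⟨by positivity, ?_⟩
    rw [hC]
    gcongr
    exact (hmb x).2
  let sg : Bool → ℝ := fun i => if i then 1 else -1
  have hsg : ∀ i, sg i = 1 ∨ sg i = -1 := by intro i; cases i <;> simp [sg]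
  let w : Bool × Bool → ℝ → ℝ → ℝ := fun i x t => sg i.1 * (u x t + sg i.2 * m x * η x t)
  have hηE : ∀ x t, (∀ i, w i x t ≤ 2 * M) → η x t ≤ E := by
    intro x t h
    have h1 := h (true, true)
    have h2 := h (false, false)
    simp only [w, sg, if_true, Bool.false_eq_true, if_false] at h1 h2
    rw [hE, le_div_iff₀ hML]
    by_contra! hcon
    have : 0 < η x t := by
      by_contra! hneg
      nlinarith
    nlinarith [(hmb x).1]
  have hbound : ∀ x t, 0 ≤ t → t ≤ T → η x t ≤ E := by
    intro x t ht htT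
    refine hηE x t fun i => ?_
    have hDt : D * t ≤ M := hDT ▸ mul_le_mul_of_nonneg_left htT hD0.le
    refine (transport_bound w C D M T hC0.le ?_ ?_ ?_ i x t ht htT).le.trans (by linarith)
    · intro i
      have h1 := hu1.continuousOn
      have h2 := hη1.continuousOn
      have h3 : Continuous m := hm.continuous
      exact continuousOn_const.mul (h1.add ((continuousOn_const.mul
        (h3.comp continuous_fst).continuousOn).mul h2))
    · rintro ⟨i, j⟩ x
      have h1 := abs_lt.1 (hs0 x)
      have h2 := abs_lt.1 (hr0 x)
      cases i <;> cases j <;> simp [w, sg] <;> linarith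
    · intro x t ht htT hle i
      have hDt : D * t ≤ M := hDT ▸ mul_le_mul_of_nonneg_left htT hD0.le
      have hηle : η x t ≤ E := hηE x t fun i => (hle i).trans (by linarith)
      have hηp := hηpos x t ht.le
      obtain ⟨hc0, hcC⟩ := hspeed x (η x t) hηp hηle
      set c := Kc * m x * η x t ^ d with hc
      have hX : HasDerivAt (fun t' => x + sg i.2 * c * (t' - t)) (sg i.2 * c) t := by
        simpa using (((hasDerivAt_id t).sub_const t).const_mul (sg i.2 * c)).const_add x
      have hXt : x + sg i.2 * c * (t - t) = x := by ring
      have au := hasDerivAt_along hu1 ht hX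
      have aη := hasDerivAt_along hη1 ht hX
      have am : HasDerivAt (fun t' => m (x + sg i.2 * c * (t' - t)))
        (deriv m (x + sg i.2 * c * (t - t)) * (sg i.2 * c)) t := (hm' _).comp t hX
      rw [hXt] at au aη am
      refine ⟨sg i.2 * c, sg i.1 * (1 / γ * (c * deriv m x * η x t)), ?_, ?_,
        ((au.fun_add ((am.const_mul (sg i.2)).fun_mul aη)).const_mul (sg i.1)).congr_deriv ?_⟩
      · rcases hsg i.2 with h | h <;> rw [h] <;> simp [abs_of_pos hc0, hcC]
      · have h1 : |c * deriv m x * η x t| ≤ C * B * E := by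
          rw [abs_mul, abs_mul, abs_of_pos hc0, abs_of_pos hηp]
          have hB : 0 ≤ B := (abs_nonneg _).trans (hmB x)
          gcongr
          exact hmB x
        have h2 : |sg i.1 * (1 / γ * (c * deriv m x * η x t))| ≤ C * B * E / γ := by
          rw [abs_mul, abs_mul, abs_of_pos (by positivity : 0 < 1 / γ), one_div,
            inv_mul_eq_div]
          have : |sg i.1| = 1 := by rcases hsg i.1 with h | h <;> simp [h]
          rw [this, one_mul]
          gcongr
        have := (le_abs_self _).trans h2
        rw [hD]
        linarith
      · rw [hut x t ht, hηt x t ht, hXt, hc]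
        have := hmpos x
        rcases hsg i.2 with h | h <;> rw [h] <;> field_simp <;> ring
  have hη := hbound x t ht htT
  exact ⟨hη, hspeed x _ (hηpos x t ht) hη⟩

/-- Gradient blowup for the isentropic-type formulation in the unknowns `u`, `η`
with a stationary coefficient `m`. -/
theorem gradient_blowup (γ κ b β d Kc ML MU M B Mstar ηL : ℝ) (hγ : 1 < γ)
    (hκ : κ = 3 * (3 - γ) / (2 * (3 * γ - 1))) (hb : b = (γ + 1) / (2 * (γ - 1)))
    (hβ : β = 2 / (3 * γ - 1)) (hd : d = (γ + 1) / (γ - 1)) (hKc : 0 < Kc) (hML : 0 < ML)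
    (hMU : 0 < MU) (hM : 0 < M) (hB : 0 ≤ B) (hMstar : 0 < Mstar) (hηL : γ < 3 → 0 < ηL) :
    ∃ N > (0:ℝ), ∀ (u η : ℝ → ℝ → ℝ) (m : ℝ → ℝ),
      ContDiffOn ℝ 2 (fun q : ℝ × ℝ => u q.1 q.2) (Set.univ ×ˢ Set.Ici (0:ℝ)) →
      ContDiffOn ℝ 2 (fun q : ℝ × ℝ => η q.1 q.2) (Set.univ ×ˢ Set.Ici (0:ℝ)) →
      ContDiff ℝ 2 m → (∀ x, ML ≤ m x ∧ m x ≤ MU) → (∀ x, |deriv m x| ≤ B) →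
      (∀ x, m x * deriv (deriv m) x
        - (3 * γ + 1) / (3 * γ - 1) * deriv m x ^ 2 ≤ Mstar) →
      (∀ x t, 0 ≤ t → 0 < η x t) → (γ < 3 → ∀ x t, 0 ≤ t → ηL ≤ η x t) →
      (∀ x t, 0 < t → pdt η x t = -(Kc * η x t ^ d * pdx u x t)) →
      (∀ x t, 0 < t → pdt u x t = -(Kc * m x * η x t ^ d * m x * pdx η x t
        + (γ - 1) / γ * (Kc * m x * η x t ^ d * η x t * deriv m x))) →
      (∀ x, |u x 0 + m x * η x 0| < M) → (∀ x, |u x 0 - m x * η x 0| < M) →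
      ∀ σ : ℝ, (σ = 1 ∨ σ = -1) → ∀ x0 : ℝ,
        m x0 ^ (-κ) * η x0 0 ^ b *
          (pdx u x0 0 + σ * (deriv m x0 * η x0 0 + m x0 * pdx η x0 0)
            - σ * β * deriv m x0 * η x0 0) < -N → False := by
  have hγ1 : 0 < γ - 1 := by linarith
  have hγ0 : 0 < γ := by linarith
  have hγ3 : 0 < 3 * γ - 1 := by linarith
  have hb0 : 0 < b := by rw [hb]; positivity
  have hd0 : 0 < d := by rw [hd]; positivity
  have hdb : d = 2 * b := by rw [hd, hb]; field_simp
  set E := 2 * M / ML with hE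
  set C := Kc * MU * E ^ d with hC
  set D := C * B * E / γ + 1 with hD
  have hE0 : 0 < E := by positivity
  have hC0 : 0 < C := by positivity
  have hD0 : 0 < D := by positivity
  set T := M / D with hT
  have hT0 : 0 < T := by positivity
  have hDT : D * T = M := by rw [hT]; field_simp
  obtain ⟨k1, hk1, hk1m⟩ := exists_pos_le_rpow ML MU κ hML
  obtain ⟨k2, hk2, hk2η⟩ : ∃ k > 0, ∀ n, 0 < n → n ≤ E → (γ < 3 → ηL ≤ n) → k ≤ n ^ (b - 1) := by
    rcases lt_or_ge γ 3 with h3 | h3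
    · obtain ⟨k, hk, hkb⟩ := exists_pos_le_rpow ηL E (b - 1) (hηL h3)
      exact ⟨k, hk, fun n _ h1 h2 => hkb n (h2 h3) h1⟩
    · refine ⟨E ^ (b - 1), rpow_pos_of_pos hE0 _, fun n h0 h1 _ => ?_⟩
      refine rpow_le_rpow_of_nonpos h0 h1 ?_
      rw [hb, sub_nonpos, div_le_one (by positivity)]
      linarith
  set a := Kc * b * k1 * k2 with ha
  have ha0 : 0 < a := by positivity
  set A := (γ - 1) / (γ * (3 * γ - 1)) * Kc * k1⁻¹ * E ^ (b + d + 1) * Mstar with hA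
  have hA0 : 0 < A := by positivity
  set N := 1 + 2 * A / a + 2 / (a * T) with hN
  have hp1 : 0 < 2 * A / a := by positivity
  have hp2 : 0 < 2 / (a * T) := by positivity
  have hN0 : 0 < N := by positivity
  refine ⟨N, hN0, ?_⟩
  intro u η m hu hη hm hmb hmB hmstar hηpos hηL' hηt hut hs0 hr0 σ hσ x0 hx0
  have hmpos : ∀ x, 0 < m x := fun x => hML.trans_le (hmb x).1
  have hu1 : ContDiffOn ℝ 1 (fun q : ℝ × ℝ => u q.1 q.2) (Set.univ ×ˢ Set.Ici (0:ℝ)) :=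
    hu.of_le (by norm_num)
  have hη1 : ContDiffOn ℝ 1 (fun q : ℝ × ℝ => η q.1 q.2) (Set.univ ×ˢ Set.Ici (0:ℝ)) :=
    hη.of_le (by norm_num)
  have hm1 : ContDiff ℝ 1 (deriv m) :=
    ((contDiff_succ_iff_deriv (n := 1)).1 (by simpa [one_add_one_eq_two] using hm)).2.2
  have hbd := short_time_bound hγ hd0 hKc hML hMU hM hE hC hD hD0 hDT hu1 hη1 hm hmb hmB hηpos
    hηt hut hs0 hr0
  have hcreg : ContDiffOn ℝ 1 (fun q : ℝ × ℝ => σ * (Kc * m q.1 * η q.1 q.2 ^ d))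
      (Set.univ ×ˢ Set.Ici (0:ℝ)) := by
    refine contDiffOn_const.mul ((contDiffOn_const.mul ?_).mul
      (hη1.rpow_const_of_ne fun q hq => (hηpos q.1 q.2 hq.2).ne'))
    exact ((hm.of_le (by norm_num)).comp contDiff_fst).contDiffOn
  obtain ⟨X, hX0, hXc, hX⟩ := exists_characteristic
    (f := fun x t => σ * (Kc * m x * η x t ^ d)) hcreg C T x0 hC0.le hT0.le (by
      intro x t ht htT
      have h1 := (hbd x t ht htT).2
      rcases hσ with h | h <;> rw [h] <;> simp [abs_of_pos h1.1, h1.2])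
  have hcurve : ContinuousOn (fun t => (X t, t)) (Set.Icc 0 T) := hXc.prodMk continuousOn_id
  have hmaps : Set.MapsTo (fun t => (X t, t)) (Set.Icc 0 T) (Set.univ ×ˢ Set.Ici (0:ℝ)) :=
    fun t ht => ⟨trivial, ht.1⟩
  have cη : ContinuousOn (fun t => η (X t) t) (Set.Icc 0 T) := hη1.continuousOn.comp hcurve hmaps
  have cP : ContinuousOn (fun t => pdx u (X t) t) (Set.Icc 0 T) :=
    (continuousOn_pdx hu1).comp hcurve hmaps
  have cQ : ContinuousOn (fun t => pdx η (X t) t) (Set.Icc 0 T) :=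
    (continuousOn_pdx hη1).comp hcurve hmaps
  have cm : ContinuousOn (fun t => m (X t)) (Set.Icc 0 T) := hm.continuous.comp_continuousOn hXc
  have cm1 : ContinuousOn (fun t => deriv m (X t)) (Set.Icc 0 T) :=
    hm1.continuous.comp_continuousOn hXc
  refine riccati_blowup _ _ A a N T ha0 hT0 hN0 ?_ ?_ ?_
    (fun t ht => hasDerivAt_weighted_gradient hγ hκ hb hβ hd hu hη hm hmpos hηpos hηt hut hσ
      ht.1 (hX t ht)) ?_ (by rw [hX0]; exact hx0)
  · have h1 : 2 * A / a ≤ N := by rw [hN]; linarith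
    have h2 : 1 ≤ N := by rw [hN]; linarith
    rw [div_le_iff₀ ha0] at h1
    nlinarith [mul_le_mul_of_nonneg_left h2 (mul_pos ha0 hN0).le]
  · have h1 : 2 / (a * T) ≤ N := by rw [hN]; linarith
    rw [div_le_iff₀ (by positivity)] at h1
    linarith
  · refine ContinuousOn.mul (ContinuousOn.mul ?_ ?_) ?_
    · exact cm.rpow_const fun t _ => Or.inl (hmpos _).ne'
    · exact cη.rpow_const fun t ht => Or.inl (hηpos _ _ ht.1).ne'
    · exact (cP.add (continuousOn_const.mul ((cm1.mul cη).add (cm.mul cQ)))).sub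
        ((continuousOn_const.mul cm1).mul cη)
  · intro t ht
    have hn := hηpos (X t) t ht.1.le
    have hnE := (hbd (X t) t ht.1.le ht.2.le).1
    have hmx := hmpos (X t)
    have hst := hmstar (X t)
    have hkm := hk1m (m (X t)) (hmb _).1 (hmb _).2
    have hkη := hk2η (η (X t) t) hn hnE fun h => hηL' h _ _ ht.1.le
    exact riccati_coefficient_bound hγ hb0 hdb hKc hMstar hk1 hk2 hmx hn hnE hkm hkη hst

/-- For `C¹` solutions of the Euler system the entropy is stationary. -/
theorem entropy_stationary {K ctau γ : ℝ} (hK : 0 < K) (hctau : 0 < ctau) (hγ : 1 < γ)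
    {τ u S p e : ℝ → ℝ → ℝ}
    (hτ1 : ContDiffOn ℝ 1 (fun q : ℝ × ℝ => τ q.1 q.2) (Set.univ ×ˢ Set.Ici (0:ℝ)))
    (hu1 : ContDiffOn ℝ 1 (fun q : ℝ × ℝ => u q.1 q.2) (Set.univ ×ˢ Set.Ici (0:ℝ)))
    (hS1 : ContDiffOn ℝ 1 (fun q : ℝ × ℝ => S q.1 q.2) (Set.univ ×ˢ Set.Ici (0:ℝ)))
    (hτpos : ∀ x t, 0 ≤ t → 0 < τ x t)
    (hp : ∀ x t, p x t = K * Real.exp (S x t / ctau) * τ x t ^ (-γ))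
    (he : ∀ x t, e x t = p x t * τ x t / (γ - 1))
    (hmass : ∀ x : ℝ, ∀ t > (0:ℝ), pdt τ x t - pdx u x t = 0)
    (hmom : ∀ x : ℝ, ∀ t > (0:ℝ), pdt u x t + pdx p x t = 0)
    (hen : ∀ x : ℝ, ∀ t > (0:ℝ),
      pdt (fun x' t' => u x' t' ^ 2 / 2 + e x' t') x t
        + pdx (fun x' t' => u x' t' * p x' t') x t = 0)
    (x t : ℝ) (ht : 0 ≤ t) : S x t = S x 0 := by
  have hγ1 : γ - 1 ≠ 0 := by linarith
  have hSt : ∀ t > 0, HasDerivAt (fun t' => S x t') 0 t := by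
    intro t ht
    have dS := hasDerivAt_pdt hS1 x ht
    have dτ := hasDerivAt_pdt hτ1 x ht
    have du := hasDerivAt_pdt hu1 x ht
    have hτ := hτpos x t ht.le
    have hp0 : 0 < p x t := by rw [hp]; positivity
    have dp : HasDerivAt (fun t' => p x t')
        (p x t * (pdt S x t / ctau) - γ * p x t * pdt τ x t / τ x t) t := by
      rw [show (fun t' => p x t') = _ from funext fun t' => hp x t']
      refine (((dS.div_const ctau).exp.const_mul K).fun_mul
        (dτ.rpow_const (p := -γ) (Or.inl hτ.ne'))).congr_deriv ?_
      rw [hp, rpow_sub_one hτ.ne']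
      field_simp
      ring
    have hpreg : ContDiffOn ℝ 1 (fun q : ℝ × ℝ => p q.1 q.2) (Set.univ ×ˢ Set.Ici (0:ℝ)) := by
      rw [show (fun q : ℝ × ℝ => p q.1 q.2) = _ from funext fun q => hp q.1 q.2]
      exact (contDiffOn_const.mul (hS1.div_const ctau).exp).mul
        (hτ1.rpow_const_of_ne fun q hq => (hτpos q.1 q.2 hq.2).ne')
    have d1 : pdt (fun x' t' => u x' t' ^ 2 / 2 + e x' t') x t = u x t * pdt u x t
        + ((p x t * (pdt S x t / ctau) - γ * p x t * pdt τ x t / τ x t) * τ x t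
          + p x t * pdt τ x t) / (γ - 1) := by
      have h1 := ((du.fun_pow 2).div_const 2).fun_add ((dp.fun_mul dτ).div_const (γ - 1))
      simp only [← he] at h1
      refine h1.deriv.trans ?_
      norm_num
      ring
    have d2 : pdx (fun x' t' => u x' t' * p x' t') x t
        = pdx u x t * p x t + u x t * pdx p x t :=
      ((hasDerivAt_pdx hu1 x ht.le).fun_mul (hasDerivAt_pdx hpreg x ht.le)).deriv
    have h1 := hen x t ht
    rw [d1, d2, eq_neg_of_add_eq_zero_left (hmom x t ht), ← sub_eq_zero.1 (hmass x t ht)] at h1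
    have h2 : p x t * τ x t * pdt S x t = 0 := by
      field_simp at h1
      linear_combination h1
    have h3 : pdt S x t = 0 := by
      rcases mul_eq_zero.1 h2 with h | h
      · exact absurd h (by positivity)
      · exact h
    rw [h3] at dS
    exact dS
  rcases ht.eq_or_lt with h | h
  · rw [h]
  · have hcont : ContinuousOn (fun t' => S x t') (Set.Icc 0 t) :=
      hS1.continuousOn.comp (f := fun t' : ℝ => (x, t')) (s := Set.Icc 0 t) (by fun_prop)
        fun s hs => ⟨trivial, hs.1⟩
    obtain ⟨ξ, _, hξ⟩ := exists_hasDerivAt_eq_slope (fun t' => S x t') (fun _ => 0) h hcont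
      fun s hs => hSt s hs.1
    rw [eq_div_iff (by linarith)] at hξ
    linarith

/-- gradient blowup (shock formation) for the one-dimensional
Lagrangian compressible Euler equations.  If the initial data are sufficiently
compressive somewhere (`y(·,0)` or `q(·,0)` below `-N`), then no global-in-time
C² solution with the stated bounds exists: `|u_x|` and/or `|τ_x|` blow up in
finite time. -/
theorem stmt1
    (K ctau γ : ℝ) (hK : 0 < K) (hctau : 0 < ctau) (hγ : 1 < γ)
    (ML MU Ms Mr V Mstar rhoL : ℝ)
    (hML : 0 < ML) (hMstar : 0 < Mstar) (hrhoL : γ < 3 → 0 < rhoL) :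
    ∃ N > (0:ℝ),
      ∀ (τ u S : ℝ → ℝ → ℝ)
        (hτreg : ContDiffOn ℝ 2 (fun q : ℝ × ℝ => τ q.1 q.2) (Set.univ ×ˢ Set.Ici (0:ℝ)))
        (hureg : ContDiffOn ℝ 2 (fun q : ℝ × ℝ => u q.1 q.2) (Set.univ ×ˢ Set.Ici (0:ℝ)))
        (hSreg : ContDiffOn ℝ 2 (fun q : ℝ × ℝ => S q.1 q.2) (Set.univ ×ˢ Set.Ici (0:ℝ)))
        (hτpos : ∀ x t, 0 ≤ t → 0 < τ x t)
        (p e : ℝ → ℝ → ℝ)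
        (hp : ∀ x t, p x t = K * Real.exp (S x t / ctau) * τ x t ^ (-γ))
        (he : ∀ x t, e x t = p x t * τ x t / (γ - 1))
        (hmass : ∀ x : ℝ, ∀ t > (0:ℝ), pdt τ x t - pdx u x t = 0)
        (hmom : ∀ x : ℝ, ∀ t > (0:ℝ), pdt u x t + pdx p x t = 0)
        (hen : ∀ x : ℝ, ∀ t > (0:ℝ),
          pdt (fun x' t' => u x' t' ^ 2 / 2 + e x' t') x t
            + pdx (fun x' t' => u x' t' * p x' t') x t = 0)
        (m η : ℝ → ℝ → ℝ)
        (hm : ∀ x t, m x t = Real.exp (S x t / (2 * ctau)))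
        (hη : ∀ x t, η x t = 2 * Real.sqrt (K * γ) / (γ - 1) * τ x t ^ (-((γ - 1) / 2)))
        (m0 : ℝ → ℝ) (hm0 : ∀ x, m0 x = m x 0)
        (hVint : Integrable (fun x => |deriv m0 x| / m0 x))
        (hV : V = ∫ x, |deriv m0 x| / m0 x)
        (hmbd : ∀ x, ML < m0 x ∧ m0 x < MU)
        (hMs : ∀ x, |m0 x ^ (-(1 / (2 * γ))) * (u x 0 + m0 x * η x 0)| < Ms)
        (hMr : ∀ x, |m0 x ^ (-(1 / (2 * γ))) * (u x 0 - m0 x * η x 0)| < Mr)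
        (hMstar' : ∀ x, m0 x * deriv (deriv m0) x
            - (3 * γ + 1) / (3 * γ - 1) * (deriv m0 x) ^ 2 ≤ Mstar)
        (hdens : γ < 3 → ∀ x t, 0 ≤ t → rhoL ≤ 1 / τ x t)
        (y q : ℝ → ℝ → ℝ)
        (hy : ∀ x t, y x t =
          m x t ^ (-(3 * (3 - γ) / (2 * (3 * γ - 1))))
            * η x t ^ ((γ + 1) / (2 * (γ - 1)))
            * (pdx (fun x' t' => u x' t' + m x' t' * η x' t') x t
                - 2 / (3 * γ - 1) * pdx m x t * η x t))
        (hq : ∀ x t, q x t =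
          m x t ^ (-(3 * (3 - γ) / (2 * (3 * γ - 1))))
            * η x t ^ ((γ + 1) / (2 * (γ - 1)))
            * (pdx (fun x' t' => u x' t' - m x' t' * η x' t') x t
                + 2 / (3 * γ - 1) * pdx m x t * η x t)),
        (∃ x, y x 0 < -N ∨ q x 0 < -N) → False := by
  have hγ1 : 0 < γ - 1 := by linarith
  have hγ0 : 0 < γ := by linarith
  have hγ3 : 0 < 3 * γ - 1 := by linarith
  have hKγ : 0 < K * γ := by positivity
  set r := Real.sqrt (K * γ) with hr
  have hr0 : 0 < r := Real.sqrt_pos.2 hKγ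
  have hrr : r * r = K * γ := Real.mul_self_sqrt hKγ.le
  set A := 2 * r / (γ - 1) with hA
  have hA0 : 0 < A := by positivity
  set β := 2 / (3 * γ - 1) with hβ
  have hβ0 : 0 < β := by positivity
  have hβ1 : β + 1 = (3 * γ + 1) / (3 * γ - 1) := by rw [hβ]; field_simp; ring
  set d := (γ + 1) / (γ - 1) with hd
  set κ := 3 * (3 - γ) / (2 * (3 * γ - 1)) with hκ
  set b := (γ + 1) / (2 * (γ - 1)) with hb
  set MU' := max ML MU with hMU'
  have hMU'0 : 0 < MU' := lt_max_of_lt_left hML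
  set B := (ML ^ (-β) + β * ML ^ (-β - 2) * Mstar) * MU' ^ (β + 1) / β with hB
  set M := MU' ^ (1 / (2 * γ)) * (|Ms| + |Mr|) + 1 with hM
  obtain ⟨N, hN0, hN⟩ := gradient_blowup γ κ b β d (r / A ^ d) ML MU' M B Mstar
    (A * (1 / rhoL) ^ (-((γ - 1) / 2))) hγ hκ hb hβ hd (by positivity) hML hMU'0 (by positivity)
    (by positivity) hMstar (fun h => by have := hrhoL h; positivity)
  refine ⟨N, hN0, ?_⟩
  intro τ u S hτreg hureg hSreg hτpos p e hp he hmass hmom hen m η hm hη m0 hm0 _ _ hmbd hMs hMr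
    hMstar' hdens y q hy hq hex
  have hτ1 : ContDiffOn ℝ 1 (fun q : ℝ × ℝ => τ q.1 q.2) (Set.univ ×ˢ Set.Ici (0:ℝ)) :=
    hτreg.of_le (by norm_num)
  have hu1 : ContDiffOn ℝ 1 (fun q : ℝ × ℝ => u q.1 q.2) (Set.univ ×ˢ Set.Ici (0:ℝ)) :=
    hureg.of_le (by norm_num)
  have hmstat : ∀ x t, 0 ≤ t → m x t = m0 x := fun x t ht => by
    rw [hm0, hm, hm, entropy_stationary hK hctau hγ hτ1 hu1 (hSreg.of_le (by norm_num)) hτpos hp he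
      hmass hmom hen x t ht]
  have hm0reg : ContDiff ℝ 2 m0 := by
    rw [show m0 = _ from funext fun x => (hm0 x).trans (hm x 0)]
    refine ContDiff.exp (ContDiff.div_const ?_ _)
    exact hSreg.comp_contDiff (f := fun x : ℝ => (x, (0:ℝ))) (by fun_prop)
      fun x => ⟨trivial, le_refl (0:ℝ)⟩
  have hm0' : ∀ x, HasDerivAt m0 (deriv m0 x) x := fun x =>
    (hm0reg.differentiable (by norm_num) x).hasDerivAt
  have hm0pos : ∀ x, 0 < m0 x := fun x => hML.trans (hmbd x).1
  have hmb' : ∀ x, ML < m0 x ∧ m0 x < MU' := fun x =>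
    ⟨(hmbd x).1, (hmbd x).2.trans_le (le_max_right _ _)⟩
  have hηreg : ContDiffOn ℝ 2 (fun q : ℝ × ℝ => η q.1 q.2) (Set.univ ×ˢ Set.Ici (0:ℝ)) := by
    rw [show (fun q : ℝ × ℝ => η q.1 q.2) = _ from funext fun q => hη q.1 q.2]
    exact contDiffOn_const.mul
      (hτreg.rpow_const_of_ne fun q hq => (hτpos q.1 q.2 hq.2).ne')
  have hη1 : ContDiffOn ℝ 1 (fun q : ℝ × ℝ => η q.1 q.2) (Set.univ ×ˢ Set.Ici (0:ℝ)) :=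
    hηreg.of_le (by norm_num)
  have hηpos : ∀ x t, 0 ≤ t → 0 < η x t := fun x t ht => by
    have := hτpos x t ht
    rw [hη]
    positivity
  have hηd : ∀ x t, 0 ≤ t → r / A ^ d * η x t ^ d = r * τ x t ^ (-((γ + 1) / 2)) := by
    intro x t ht
    have hτ := hτpos x t ht
    rw [hη, mul_rpow hA0.le (rpow_nonneg hτ.le _), ← rpow_mul hτ.le,
      show -((γ - 1) / 2) * d = -((γ + 1) / 2) by rw [hd]; field_simp]
    field_simp
  have hexp : -((γ - 1) / 2) - 1 = -((γ + 1) / 2) := by ring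
  have hηt : ∀ x t, 0 < t → pdt η x t = -(r / A ^ d * η x t ^ d * pdx u x t) := by
    intro x t ht
    have h1 := ((hasDerivAt_pdt hτ1 x ht).rpow_const (p := -((γ - 1) / 2))
      (Or.inl (hτpos x t ht.le).ne')).const_mul A
    rw [← show (fun t' => η x t') = _ from funext fun t' => hη x t'] at h1
    rw [hηd x t ht.le, ← sub_eq_zero.1 (hmass x t ht)]
    refine h1.deriv.trans ?_
    rw [hexp, hA]
    field_simp
  have hηx : ∀ x t, 0 ≤ t → pdx η x t = -(r * τ x t ^ (-((γ + 1) / 2)) * pdx τ x t) := by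
    intro x t ht
    have h1 := ((hasDerivAt_pdx hτ1 x ht).rpow_const (p := -((γ - 1) / 2))
      (Or.inl (hτpos x t ht).ne')).const_mul A
    rw [← show (fun x' => η x' t) = _ from funext fun x' => hη x' t] at h1
    refine h1.deriv.trans ?_
    rw [hexp, hA]
    field_simp
  have hut : ∀ x t, 0 < t → pdt u x t = -(r / A ^ d * m0 x * η x t ^ d * m0 x * pdx η x t
      + (γ - 1) / γ * (r / A ^ d * m0 x * η x t ^ d * η x t * deriv m0 x)) := by
    intro x t ht
    have hτ := hτpos x t ht.le
    have h1 := (((hm0' x).fun_pow 2).const_mul K).fun_mul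
      ((hasDerivAt_pdx hτ1 x ht.le).rpow_const (p := -γ) (Or.inl hτ.ne'))
    have hpm : ∀ x', K * m0 x' ^ 2 * τ x' t ^ (-γ) = p x' t := by
      intro x'
      rw [hp, ← hmstat x' t ht.le, hm, ← Real.exp_nat_mul]
      congr 3
      push_cast
      field_simp
    simp only [hpm] at h1
    have h2 : pdx p x t = _ := h1.deriv
    have e1 : τ x t ^ (-γ) = τ x t ^ (-((γ + 1) / 2)) * τ x t ^ (-((γ - 1) / 2)) := by
      rw [← rpow_add hτ]; congr 1; ring
    have e2 : τ x t ^ (-γ - 1) = τ x t ^ (-((γ + 1) / 2)) * τ x t ^ (-((γ + 1) / 2)) := by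
      rw [← rpow_add hτ]; congr 1; ring
    rw [eq_neg_of_add_eq_zero_left (hmom x t ht), h2, e1, e2,
      show r / A ^ d * m0 x * η x t ^ d * m0 x * pdx η x t
        + (γ - 1) / γ * (r / A ^ d * m0 x * η x t ^ d * η x t * deriv m0 x)
        = (r / A ^ d * η x t ^ d) * (m0 x ^ 2 * pdx η x t
          + (γ - 1) / γ * (m0 x * η x t * deriv m0 x)) by ring,
      hηd x t ht.le, hηx x t ht.le, hη, hA]
    have hK' : K = r * r / γ := by rw [hrr]; field_simp
    rw [hK']
    field_simp
    norm_num
    ring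
  have hinit : ∀ (c : ℝ) (x : ℝ), |m0 x ^ (-(1 / (2 * γ))) * c| < |Ms| + |Mr| → |c| < M := by
    intro c x h
    have h1 : 0 < m0 x ^ (1 / (2 * γ)) := rpow_pos_of_pos (hm0pos x) _
    rw [rpow_neg (hm0pos x).le, abs_mul, abs_of_pos (inv_pos.2 h1), inv_mul_lt_iff₀ h1] at h
    have h2 : m0 x ^ (1 / (2 * γ)) ≤ MU' ^ (1 / (2 * γ)) :=
      rpow_le_rpow (hm0pos x).le (hmb' x).2.le (by positivity)
    have h3 := mul_le_mul_of_nonneg_right h2 (by positivity : 0 ≤ |Ms| + |Mr|)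
    linarith
  have main := hN u η m0 hureg hηreg hm0reg (fun x => ⟨(hmb' x).1.le, (hmb' x).2.le⟩)
    (abs_deriv_le_of_semiconvex m0 hm0reg β ML MU' Mstar hβ0 hML hMstar hmb'
      (by rw [hβ1]; exact hMstar')) hMstar' hηpos
    (by
      intro h x t ht
      have hτ := hτpos x t ht
      have h1 := hdens h x t ht
      have h2 := hrhoL h
      rw [hη]
      refine mul_le_mul_of_nonneg_left (rpow_le_rpow_of_nonpos hτ ?_ (by linarith)) hA0.le
      rw [le_div_iff₀ hτ] at h1
      rw [le_div_iff₀ h2]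
      linarith) hηt hut
    (fun x => hinit _ x (by linarith [hMs x, le_abs_self Ms, abs_nonneg Mr]))
    (fun x => hinit _ x (by linarith [hMr x, le_abs_self Mr, abs_nonneg Ms]))
  obtain ⟨x, hx⟩ := hex
  have dm : pdx m x 0 = deriv m0 x := by
    rw [show m0 = fun x' => m x' 0 from funext hm0]; rfl
  have du := hasDerivAt_pdx hu1 x (le_refl 0)
  have dη := hasDerivAt_pdx hη1 x (le_refl 0)
  rcases hx with hx | hx
  · refine main 1 (Or.inl rfl) x (lt_of_eq_of_lt ?_ hx)
    have h1 : pdx (fun x' t' => u x' t' + m x' t' * η x' t') x 0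
        = pdx u x 0 + (deriv m0 x * η x 0 + m0 x * pdx η x 0) := by
      have h2 := du.fun_add ((hm0' x).fun_mul dη)
      rw [show m0 = fun x' => m x' 0 from funext hm0] at h2 ⊢
      exact h2.deriv
    rw [hy, h1, dm, ← hm0]
    ring
  · refine main (-1) (Or.inr rfl) x (lt_of_eq_of_lt ?_ hx)
    have h1 : pdx (fun x' t' => u x' t' - m x' t' * η x' t') x 0
        = pdx u x 0 - (deriv m0 x * η x 0 + m0 x * pdx η x 0) := by
      have h2 := du.fun_sub ((hm0' x).fun_mul dη)
      rw [show m0 = fun x' => m x' 0 from funext hm0] at h2 ⊢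
      exact h2.deriv
    rw [hq, h1, dm, ← hm0]
    ring
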